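/- Let a ∈ ℂ and b > 0 be real, and define E : ℂ → ℝ by E(u) = |1 − conj(u)·a|² + |u|²·b. Then −log₂(inf_{u ∈ ℂ} E(u)) = log₂(1 + |a|²/b). (The negative binary logarithm of the minimum mean-square error equals the achievable rate log₂(1 + SINR) with SINR = |a|²/b; this is the key identity underlying the equivalence between the weighted-MMSE problem and the sum-rate maximization problem.) -/

import Mathlib

/-- Completing the square in the mean-square error around the MMSE equalizer
`a / (‖a‖ ^ 2 + b)`. -/
theorem mse_eq_complete_square (a u : ℂ) {b : ℝ} (hb : 0 < b) :
    ‖1 - (starRingEnd ℂ) u * a‖ ^ 2 + ‖u‖ ^ 2 * b =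
      (‖a‖ ^ 2 + b) * ‖u - ((‖a‖ ^ 2 + b)⁻¹ : ℝ) * a‖ ^ 2 + b / (‖a‖ ^ 2 + b) := by
  have hs : ‖a‖ ^ 2 + b ≠ 0 := by positivity
  have ha : ‖a‖ ^ 2 = a.re * a.re + a.im * a.im := by
    rw [Complex.sq_norm, Complex.normSq_apply]
  rw [ha] at hs ⊢
  simp only [Complex.sq_norm, Complex.normSq_apply, Complex.sub_re, Complex.sub_im,
    Complex.mul_re, Complex.mul_im, Complex.conj_re, Complex.conj_im, Complex.one_re,
    Complex.one_im, Complex.ofReal_re, Complex.ofReal_im]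
  field_simp
  ring

/-- The minimum mean-square error is `b / (‖a‖ ^ 2 + b)`. -/
theorem isLeast_range_mse (a : ℂ) {b : ℝ} (hb : 0 < b) :
    IsLeast (Set.range fun u : ℂ => ‖1 - (starRingEnd ℂ) u * a‖ ^ 2 + ‖u‖ ^ 2 * b)
      (b / (‖a‖ ^ 2 + b)) := by
  simp only [mse_eq_complete_square a _ hb]
  refine ⟨⟨((‖a‖ ^ 2 + b)⁻¹ : ℝ) * a, by simp⟩, ?_⟩
  rintro _ ⟨u, rfl⟩
  exact le_add_of_nonneg_left (by positivity)

/-- Rate–MMSE identity: the negative binary logarithm of the minimum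
mean-square error equals the achievable rate log₂(1 + |a|²/b). -/
theorem neg_log_min_mse_eq_rate (a : ℂ) (b : ℝ) (hb : 0 < b)
    (E : ℂ → ℝ) (hE : ∀ u, E u = ‖1 - (starRingEnd ℂ) u * a‖ ^ 2 + ‖u‖ ^ 2 * b) :
    -Real.logb 2 (⨅ u : ℂ, E u) = Real.logb 2 (1 + ‖a‖ ^ 2 / b) := by
  have hmin : ⨅ u : ℂ, E u = b / (‖a‖ ^ 2 + b) := by
    rw [funext hE]
    exact (isLeast_range_mse a hb).csInf_eq
  rw [hmin, ← Real.logb_inv, inv_div, add_div, div_self hb.ne', add_comm]
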